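/- arXiv:1305.1748 — 2 statements merged into one kernel-verified Lean document; each statement's English description precedes it below -/
import Mathlib

section
/- Let S be a Frobenius Poisson algebra over a field k with nondegenerate associative symmetric bilinear form ⟨-,-⟩, let m, n ≥ 1, P ∈ 𝔛^m(S), Q ∈ 𝔛^n(S). Define (P∧₁Q)(a_1,…,a_{m+n}) := Σ_{θ ∈ S_{m,n}, θ(m)=m+n} ε(θ) P(a_{θ(1)},…,a_{θ(m)}) Q(a_{θ(m+1)},…,a_{θ(m+n)}). Suppose DP : S^{m−1} → S satisfies ⟨DP(a_1,…,a_{m−1}), a_m⟩ = (−1)^{m−1} ⟨P(a_1,…,a_m), 1⟩ for all a_i ∈ S, and D₁ : S^{m+n−1} → S satisfies ⟨D₁(a_1,…,a_{m+n−1}), a_{m+n}⟩ = (−1)^{m+n−1} ⟨(P∧₁Q)(a_1,…,a_{m+n}), 1⟩ for all a_i ∈ S. Then P∘Q + (−1)^{(m−1)n} (D₁ − DP∧Q) = 0 as maps S^{m+n−1} → S. -/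
section PolyDer

variable (k : Type*) [Field k] (S : Type*) [CommRing S] [Algebra k S]

/-- `P : S^m → S` is `k`-multilinear. -/
def IsMultilin (m : ℕ) (P : (Fin m → S) → S) : Prop :=
  (∀ (a : Fin m → S) (i : Fin m) (x y : S),
      P (Function.update a i (x + y)) = P (Function.update a i x) + P (Function.update a i y)) ∧
  (∀ (a : Fin m → S) (i : Fin m) (c : k) (x : S),
      P (Function.update a i (c • x)) = c • P (Function.update a i x))

/-- `P : S^m → S` is skew-symmetric:
`P(a_1, …, a_m) = ε(θ) P(a_{θ(1)}, …, a_{θ(m)})` for every permutation `θ`. -/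
def IsSkewSym (m : ℕ) (P : (Fin m → S) → S) : Prop :=
  ∀ (θ : Equiv.Perm (Fin m)) (a : Fin m → S),
    P a = (Equiv.Perm.sign θ : ℤ) • P (fun i => a (θ i))

/-- `P : S^m → S` is a derivation in each argument. -/
def IsMultiDer (m : ℕ) (P : (Fin m → S) → S) : Prop :=
  ∀ (a : Fin m → S) (i : Fin m) (x y : S),
    P (Function.update a i (x * y)) =
      x * P (Function.update a i y) + y * P (Function.update a i x)

/-- membership in `𝔛^m(S)`: `k`-multilinear, skew-symmetric, and a derivation
in each argument (`𝔛^0(S) = S` since `(Fin 0 → S) → S ≅ S`). -/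
def IsPolyDer (m : ℕ) (P : (Fin m → S) → S) : Prop :=
  IsMultilin k S m P ∧ IsSkewSym S m P ∧ IsMultiDer S m P

end PolyDer

section Shuffles

variable (k : Type*) [Field k] (S : Type*) [CommRing S] [Algebra k S]

/-- `θ` is a `(p, r−p)`-shuffle: `θ` is increasing on `{0, …, p−1}` and on
`{p, …, r−1}` (0-based indexing). -/
def IsShuffle {r : ℕ} (p : ℕ) (θ : Equiv.Perm (Fin r)) : Prop :=
  ∀ i j : Fin r, i < j → ((j : ℕ) < p ∨ p ≤ (i : ℕ)) → θ i < θ j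

instance {r : ℕ} (p : ℕ) (θ : Equiv.Perm (Fin r)) : Decidable (IsShuffle p θ) := by
  unfold IsShuffle; infer_instance

/-- The wedge product
`(P∧Q)(a_1,…,a_r) = Σ_{θ ∈ S_{m,n}} ε(θ) P(a_{θ(1)},…,a_{θ(m)}) Q(a_{θ(m+1)},…,a_{θ(m+n)})`
of multilinear maps `P : S^m → S` and `Q : S^n → S`, with `r = m + n`. -/
noncomputable def wedgeProd (m n r : ℕ) (h : m + n = r)
    (P : (Fin m → S) → S) (Q : (Fin n → S) → S) : (Fin r → S) → S := fun a =>
  ∑ θ : Equiv.Perm (Fin r),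
    if IsShuffle m θ then
      (Equiv.Perm.sign θ : ℤ) •
        (P (fun i => a (θ ⟨(i : ℕ), by have := i.isLt; omega⟩)) *
         Q (fun j => a (θ ⟨m + (j : ℕ), by have := j.isLt; omega⟩)))
    else 0

/-- The partial wedge product `P ∧₁ Q`: only the shuffles with `θ(m) = m+n`
(`1`-based), i.e. `θ(m−1) = r−1` (0-based), contribute. -/
noncomputable def wedgeFstProd (m n r : ℕ) (h : m + n = r) (hm : 1 ≤ m)
    (P : (Fin m → S) → S) (Q : (Fin n → S) → S) : (Fin r → S) → S := fun a =>
  ∑ θ : Equiv.Perm (Fin r),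
    if IsShuffle m θ ∧ θ ⟨m - 1, by omega⟩ = ⟨r - 1, by omega⟩ then
      (Equiv.Perm.sign θ : ℤ) •
        (P (fun i => a (θ ⟨(i : ℕ), by have := i.isLt; omega⟩)) *
         Q (fun j => a (θ ⟨m + (j : ℕ), by have := j.isLt; omega⟩)))
    else 0

/-- The partial wedge product `P ∧₂ Q`: only the shuffles with
`θ(m+n) = m+n` (`1`-based), i.e. `θ(r−1) = r−1` (0-based), contribute. -/
noncomputable def wedgeSndProd (m n r : ℕ) (h : m + n = r) (hm : 1 ≤ m)
    (P : (Fin m → S) → S) (Q : (Fin n → S) → S) : (Fin r → S) → S := fun a =>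
  ∑ θ : Equiv.Perm (Fin r),
    if IsShuffle m θ ∧ θ ⟨r - 1, by omega⟩ = ⟨r - 1, by omega⟩ then
      (Equiv.Perm.sign θ : ℤ) •
        (P (fun i => a (θ ⟨(i : ℕ), by have := i.isLt; omega⟩)) *
         Q (fun j => a (θ ⟨m + (j : ℕ), by have := j.isLt; omega⟩)))
    else 0

/-- The circle product
`(P∘Q)(a_1,…,a_r) = Σ_{θ ∈ S_{n,m−1}} ε(θ) P(Q(a_{θ(1)},…,a_{θ(n)}), a_{θ(n+1)},…,a_{θ(n+m−1)})`
of multilinear maps `P : S^m → S` and `Q : S^n → S`, with `r = m + n − 1`,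
`m ≥ 1`. -/
noncomputable def circProd (m n r : ℕ) (h : m + n = r + 1) (hm : 1 ≤ m)
    (P : (Fin m → S) → S) (Q : (Fin n → S) → S) : (Fin r → S) → S := fun a =>
  ∑ θ : Equiv.Perm (Fin r),
    if IsShuffle n θ then
      (Equiv.Perm.sign θ : ℤ) • P (fun l =>
        if h0 : (l : ℕ) = 0 then
          Q (fun i => a (θ ⟨(i : ℕ), by have := i.isLt; omega⟩))
        else a (θ ⟨n + ((l : ℕ) - 1), by have := l.isLt; omega⟩))
    else 0

end Shuffles

section ShuffleReindexing

open Equiv Equiv.Perm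

/-- The extension of a permutation of `Fin r` to `Fin (r + 1)` fixing the last element. -/
def extendLast {r : ℕ} (σ : Perm (Fin r)) : Perm (Fin (r + 1)) :=
  finSuccEquivLast.symm.permCongr σ.optionCongr

@[simp]
theorem extendLast_castSucc {r : ℕ} (σ : Perm (Fin r)) (i : Fin r) :
    extendLast σ i.castSucc = (σ i).castSucc := by
  simp [extendLast, Equiv.permCongr_apply]

@[simp]
theorem extendLast_last {r : ℕ} (σ : Perm (Fin r)) :
    extendLast σ (Fin.last r) = Fin.last r := by
  simp [extendLast, Equiv.permCongr_apply]

theorem sign_extendLast {r : ℕ} (σ : Perm (Fin r)) : sign (extendLast σ) = sign σ := by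
  rw [extendLast, sign_permCongr, optionCongr_sign]

theorem extendLast_injective {r : ℕ} : Function.Injective (extendLast (r := r)) := by
  intro σ τ h
  ext i
  have := congrArg (fun e => e i.castSucc) h
  simpa using congrArg Fin.val this

theorem exists_extendLast_eq {r : ℕ} (θ : Perm (Fin (r + 1))) (h : θ (Fin.last r) = Fin.last r) :
    ∃ σ, extendLast σ = θ := by
  have hn : (finSuccEquivLast.permCongr θ) none = none := by
    simp [Equiv.permCongr_apply, h]
  obtain ⟨⟨x, σ⟩, hσ⟩ := decomposeOption.symm.surjective (finSuccEquivLast.permCongr θ)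
  have hx : x = none := by
    rw [← hσ] at hn
    simpa using hn
  subst hx
  refine ⟨σ, ?_⟩
  have : σ.optionCongr = finSuccEquivLast.permCongr θ := by
    rw [← hσ]; simp [Perm.one_def]
  rw [extendLast, this]
  ext i
  simp [Equiv.permCongr_apply]

/-- A sum over the permutations sending `c` to the last element, reindexed along a fixed
permutation `ρ` sending `c` to the last element. -/
theorem sum_perm_apply_eq_last {M : Type*} [AddCommMonoid M] {r : ℕ} (c : Fin (r + 1))
    (ρ : Perm (Fin (r + 1))) (hρ : ρ c = Fin.last r)
    (C : Perm (Fin (r + 1)) → Prop) [DecidablePred C] (f : Perm (Fin (r + 1)) → M) :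
    (∑ θ, if C θ ∧ θ c = Fin.last r then f θ else 0) =
      ∑ σ : Perm (Fin r), if C (extendLast σ * ρ) then f (extendLast σ * ρ) else 0 := by
  symm
  refine Finset.sum_of_injOn (fun σ => extendLast σ * ρ) ?_ (by simp) ?_ ?_
  · intro σ _ τ _ h
    exact extendLast_injective (mul_right_cancel h)
  · intro θ _ hθ
    rw [if_neg]
    rintro ⟨_, hc⟩
    obtain ⟨σ, hσ⟩ := exists_extendLast_eq (θ * ρ⁻¹) (by
      rw [Perm.mul_apply, Perm.inv_eq_iff_eq.2 hρ.symm, hc])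
    exact hθ ⟨σ, by simp, by simp [hσ]⟩
  · intro σ _
    simp [hρ]

/-- The cycle sending `p` to the last element and preserving the order of the others. -/
def moveToLast {r : ℕ} (p : Fin (r + 1)) : Perm (Fin (r + 1)) :=
  (finRotate (r + 1))⁻¹ * p.cycleRange

theorem moveToLast_self {r : ℕ} (p : Fin (r + 1)) : moveToLast p p = Fin.last r := by
  rw [moveToLast, Perm.mul_apply, Perm.inv_eq_iff_eq, finRotate_last, Fin.cycleRange_self]

theorem moveToLast_succAbove {r : ℕ} (p : Fin (r + 1)) (j : Fin r) :
    moveToLast p (p.succAbove j) = j.castSucc := by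
  rw [moveToLast, Perm.mul_apply, Perm.inv_eq_iff_eq, Fin.cycleRange_succAbove,
    finRotate_apply, Fin.coeSucc_eq_succ]

theorem sign_moveToLast {r : ℕ} (p : Fin (r + 1)) :
    sign (moveToLast p) = (-1) ^ (r + (p : ℕ)) := by
  rw [moveToLast, Perm.sign_mul, Perm.sign_inv, sign_finRotate, Fin.sign_cycleRange, pow_add,
    Nat.add_sub_cancel]

theorem moveToLast_of_lt {r : ℕ} (p : Fin (r + 1)) (i : ℕ) (hi : i < p) :
    moveToLast p ⟨i, by omega⟩ = Fin.castSucc ⟨i, by omega⟩ := by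
  rw [← moveToLast_succAbove p, Fin.succAbove_of_castSucc_lt]
  · rfl
  · exact hi

theorem moveToLast_of_ge {r : ℕ} (p : Fin (r + 1)) (i : ℕ) (hi : (p : ℕ) ≤ i) (hr : i < r) :
    moveToLast p ⟨i + 1, by omega⟩ = Fin.castSucc ⟨i, hr⟩ := by
  rw [← moveToLast_succAbove p, Fin.succAbove_of_le_castSucc]
  · rfl
  · exact hi

theorem isShuffle_iff_strictMono {m n r : ℕ} (h : m + n = r) (θ : Perm (Fin r)) :
    IsShuffle m θ ↔
      StrictMono (fun i : Fin m => θ ⟨i, by omega⟩) ∧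
      StrictMono (fun j : Fin n => θ ⟨m + j, by omega⟩) := by
  constructor
  · intro hθ
    exact ⟨fun i j hij => hθ _ _ hij (Or.inl j.isLt),
      fun i j hij => hθ _ _ (Nat.add_lt_add_left hij m) (Or.inr (Nat.le_add_right m i))⟩
  · rintro ⟨h₁, h₂⟩ i j hij (hj | hi)
    · exact @h₁ ⟨i, lt_trans hij hj⟩ ⟨j, hj⟩ hij
    · have hij' : (i : ℕ) < j := hij
      have := @h₂ ⟨i - m, by omega⟩ ⟨j - m, by omega⟩ (Fin.mk_lt_mk.2 (by omega))
      have e₁ : m + ((i : ℕ) - m) = i := by omega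
      have e₂ : m + ((j : ℕ) - m) = j := by omega
      simpa only [e₁, e₂] using this

theorem isShuffle_extendLast_mul_moveToLast {m n r : ℕ} (h : m + n = r) (σ : Perm (Fin r)) :
    IsShuffle (m + 1) (extendLast σ * moveToLast ⟨m, by omega⟩) ↔ IsShuffle m σ := by
  rw [isShuffle_iff_strictMono (n := n) (by omega), isShuffle_iff_strictMono h]
  refine and_congr ?_ ?_
  · have hlt (i : Fin m) : (extendLast σ * moveToLast (⟨m, by omega⟩ : Fin (r + 1)))
        ⟨i.castSucc, by simp; omega⟩ = (σ ⟨i, by omega⟩).castSucc := by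
      have := moveToLast_of_lt (⟨m, by omega⟩ : Fin (r + 1)) i i.isLt
      simp only [Fin.val_castSucc, Perm.mul_apply, this, extendLast_castSucc]
    have hlast : (extendLast σ * moveToLast (⟨m, by omega⟩ : Fin (r + 1)))
        ⟨Fin.last m, by simp; omega⟩ = Fin.last r := by
      simp only [Fin.val_last, Perm.mul_apply, moveToLast_self, extendLast_last]
    constructor
    · intro H i j hij
      have := @H i.castSucc j.castSucc hij
      simpa only [hlt, Fin.castSucc_lt_castSucc_iff] using this
    · intro H i j hij
      induction j using Fin.lastCases with
      | last =>
        induction i using Fin.lastCases with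
        | last => exact absurd hij (lt_irrefl _)
        | cast i => simpa only [hlt, hlast] using Fin.castSucc_lt_last _
      | cast j =>
        induction i using Fin.lastCases with
        | last => exact absurd hij (not_lt_of_ge (Fin.le_last _))
        | cast i => simpa only [hlt, Fin.castSucc_lt_castSucc_iff] using @H i j hij
  · have hgt (j : Fin n) : (extendLast σ * moveToLast (⟨m, by omega⟩ : Fin (r + 1)))
        ⟨m + 1 + j, by omega⟩ = (σ ⟨m + j, by omega⟩).castSucc := by
      have := moveToLast_of_ge (⟨m, by omega⟩ : Fin (r + 1)) (m + j) (by simp) (by omega)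
      simp only [Perm.mul_apply, show m + 1 + (j : ℕ) = m + j + 1 by omega, this,
        extendLast_castSucc]
    simp only [hgt]
    rfl

theorem sign_finCycle {r : ℕ} (k : Fin r) : sign (finCycle k) = (-1) ^ ((r - 1) * k) := by
  have : finCycle k = finRotate r ^ (k : ℕ) := by
    ext i
    rw [finCycle_eq_finRotate_iterate, Perm.iterate_eq_pow]
  rw [this, map_pow, sign_finRotate, pow_mul]

theorem finCycle_mk_of_lt {m n r : ℕ} (h : m + n = r) (hm : m < r) (i : Fin n) :
    finCycle (⟨m, hm⟩ : Fin r) ⟨i, by omega⟩ = ⟨m + i, by omega⟩ := by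
  ext
  rw [finCycle_apply, Fin.val_add, Nat.mod_eq_of_lt (by simp only []; omega), Nat.add_comm]

theorem finCycle_mk_of_ge {m n r : ℕ} (h : m + n = r) (hm : m < r) (j : Fin m) :
    finCycle (⟨m, hm⟩ : Fin r) ⟨n + j, by omega⟩ = ⟨j, by omega⟩ := by
  ext
  rw [finCycle_apply, Fin.val_add, show n + (j : ℕ) + m = j + r by omega, Nat.add_mod_right,
    Nat.mod_eq_of_lt (by omega)]

theorem isShuffle_mul_finCycle {m n r : ℕ} (h : m + n = r) (hm : m < r) (σ : Perm (Fin r)) :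
    IsShuffle n (σ * finCycle ⟨m, hm⟩) ↔ IsShuffle m σ := by
  rw [isShuffle_iff_strictMono (n := m) (by omega), isShuffle_iff_strictMono h, and_comm]
  simp only [Perm.mul_apply, finCycle_mk_of_lt h hm, finCycle_mk_of_ge h hm]

end ShuffleReindexing

section PartialProducts

open Equiv Equiv.Perm

variable {S : Type*} [CommRing S]

theorem IsSkewSym.cons_eq_snoc {p : ℕ} {P : (Fin (p + 1) → S) → S} (hP : IsSkewSym S (p + 1) P)
    (x : S) (b : Fin p → S) :
    P (Fin.cons x b) = (-1 : ℤ) ^ p • P (Fin.snoc b x) := by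
  rw [hP (finRotate (p + 1)) (Fin.cons x b), sign_finRotate, Fin.snoc_eq_cons_rotate]
  simp

theorem IsMultiDer.snoc_mul {p : ℕ} {P : (Fin (p + 1) → S) → S} (hP : IsMultiDer S (p + 1) P)
    (b : Fin p → S) (x y : S) :
    P (Fin.snoc b (x * y)) = x * P (Fin.snoc b y) + y * P (Fin.snoc b x) := by
  simpa only [Fin.update_snoc_last] using hP (Fin.snoc b 0) (Fin.last p) x y

/-- `(P ∧₁ Q)(a, x)` is, up to sign, the wedge product of `P(-, x)` and `Q` at `a`. -/
theorem wedgeFstProd_snoc (p n r : ℕ) (h : p + n = r) (P : (Fin (p + 1) → S) → S)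
    (Q : (Fin n → S) → S) (a : Fin r → S) (x : S) :
    wedgeFstProd S (p + 1) n (r + 1) (by omega) (by omega) P Q (Fin.snoc a x) =
      (-1 : ℤ) ^ n • wedgeProd S p n r h (fun b => P (Fin.snoc b x)) Q a := by
  have key := sum_perm_apply_eq_last (⟨p, by omega⟩ : Fin (r + 1)) (moveToLast ⟨p, by omega⟩)
    (moveToLast_self _) (IsShuffle (p + 1)) (fun θ => (sign θ : ℤ) •
        (P (fun i => (Fin.snoc a x : Fin (r + 1) → S) (θ ⟨(i : ℕ), by omega⟩)) *
         Q (fun j => (Fin.snoc a x : Fin (r + 1) → S) (θ ⟨p + 1 + (j : ℕ), by omega⟩))))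
  refine key.trans ?_
  rw [wedgeProd, Finset.smul_sum]
  refine Finset.sum_congr rfl fun σ _ => ?_
  simp only [isShuffle_extendLast_mul_moveToLast h, smul_ite, smul_zero]
  refine if_congr Iff.rfl ?_ rfl
  have hsign : (sign (extendLast σ * moveToLast (⟨p, by omega⟩ : Fin (r + 1))) : ℤ) =
      (-1) ^ n * (sign σ : ℤ) := by
    rw [Perm.sign_mul, sign_extendLast, sign_moveToLast, Fin.val_mk,
      show r + p = 2 * p + n by omega, pow_add, pow_mul]
    simp [mul_comm]
  have hP' : (fun i : Fin (p + 1) => (Fin.snoc a x : Fin (r + 1) → S)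
      ((extendLast σ * moveToLast (⟨p, by omega⟩ : Fin (r + 1))) ⟨(i : ℕ), by omega⟩)) =
      Fin.snoc (fun i : Fin p => a (σ ⟨i, by omega⟩)) x := by
    funext i
    induction i using Fin.lastCases with
    | last => simp [moveToLast_self]
    | cast i =>
      have := moveToLast_of_lt (⟨p, by omega⟩ : Fin (r + 1)) i i.isLt
      simp only [Fin.val_castSucc, Perm.mul_apply, this, extendLast_castSucc, Fin.snoc_castSucc]
  have hQ' : (fun j : Fin n => (Fin.snoc a x : Fin (r + 1) → S)
      ((extendLast σ * moveToLast (⟨p, by omega⟩ : Fin (r + 1))) ⟨p + 1 + (j : ℕ), by omega⟩)) =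
      fun j : Fin n => a (σ ⟨p + j, by omega⟩) := by
    funext j
    have := moveToLast_of_ge (⟨p, by omega⟩ : Fin (r + 1)) (p + j) (by simp) (by omega)
    simp only [Perm.mul_apply, show p + 1 + (j : ℕ) = p + j + 1 by omega, this,
      extendLast_castSucc, Fin.snoc_castSucc]
  rw [hsign, hP', hQ', mul_smul]

/-- `P ∘ Q` as a sum over the shuffles that put the arguments of `Q` last. -/
theorem circProd_eq_sum_snoc (p n r : ℕ) (h : p + n = r) (hp : p < r)
    (P : (Fin (p + 1) → S) → S) (hP : IsSkewSym S (p + 1) P)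
    (Q : (Fin n → S) → S) (a : Fin r → S) :
    circProd S (p + 1) n r (by omega) (by omega) P Q a =
      ((-1 : ℤ) ^ (p * n) * (-1) ^ p) • ∑ σ : Perm (Fin r), if IsShuffle p σ then
        (sign σ : ℤ) • P (Fin.snoc (fun i => a (σ ⟨(i : ℕ), by omega⟩))
          (Q (fun j => a (σ ⟨p + (j : ℕ), by omega⟩)))) else 0 := by
  rw [circProd, ← Equiv.sum_comp (Equiv.mulRight (finCycle (⟨p, hp⟩ : Fin r))), Finset.smul_sum]
  refine Finset.sum_congr rfl fun σ _ => ?_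
  simp only [Equiv.coe_mulRight, isShuffle_mul_finCycle h, smul_ite, smul_zero]
  refine if_congr Iff.rfl ?_ rfl
  have hsign : (sign (σ * finCycle (⟨p, hp⟩ : Fin r)) : ℤ) = (-1) ^ (p * n) * (sign σ : ℤ) := by
    have hparity : (-1 : ℤ) ^ ((r - 1) * p) = (-1) ^ (p * n) := by
      obtain ⟨n, rfl⟩ : ∃ l, n = l + 1 := ⟨n - 1, by omega⟩
      rw [show r - 1 = p + n by omega]
      apply neg_one_pow_congr
      simp only [Nat.even_mul, Nat.even_add, Nat.even_add_one]
      tauto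
    rw [Perm.sign_mul, sign_finCycle, ← hparity]
    simp [mul_comm]
  have harg : (fun l : Fin (p + 1) => if h0 : (l : ℕ) = 0 then
        Q (fun i => a ((σ * finCycle (⟨p, hp⟩ : Fin r)) ⟨(i : ℕ), by omega⟩))
      else a ((σ * finCycle (⟨p, hp⟩ : Fin r)) ⟨n + ((l : ℕ) - 1), by omega⟩)) =
      Fin.cons (Q (fun j => a (σ ⟨p + (j : ℕ), by omega⟩)))
        (fun i : Fin p => a (σ ⟨(i : ℕ), by omega⟩)) := by
    funext l
    induction l using Fin.cases with
    | zero => simp [finCycle_mk_of_lt h hp]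
    | succ l => simp [finCycle_mk_of_ge h hp]
  rw [hsign, harg, hP.cons_eq_snoc, smul_smul, smul_smul]
  congr 1
  ring

end PartialProducts

/-- the `∧₁`-identity
`P∘Q + (−1)^{(m−1)n} (Δ(P∧₁Q) − Δ(P)∧Q) = 0`, with `m = p+1`, `n = q+1`. -/
theorem bv_wedge_one_identity
    (k : Type*) [Field k] (S : Type*) [CommRing S] [Algebra k S]
    [FiniteDimensional k S]
    -- the Poisson bracket on S, k-bilinear
    (br : S →ₗ[k] S →ₗ[k] S)
    (hanti : ∀ a b : S, br a b = - br b a)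
    (hjacobi : ∀ a b c : S, br a (br b c) + br b (br c a) + br c (br a b) = 0)
    (hleib : ∀ a b c : S, br a (b * c) = br a b * c + br a c * b)
    -- the Frobenius bilinear form ⟨-,-⟩, nondegenerate, associative, symmetric
    (B : S →ₗ[k] S →ₗ[k] k)
    (hBnd : ∀ a : S, (∀ b : S, B a b = 0) → a = 0)
    (hBassoc : ∀ a b c : S, B (a * b) c = B a (b * c))
    (hBsymm : ∀ a b : S, B a b = B b a)
    -- P ∈ 𝔛^{p+1}(S), Q ∈ 𝔛^{q+1}(S)
    (p q : ℕ)
    (P : (Fin (p+1) → S) → S) (hP : IsPolyDer k S (p+1) P)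
    (Q : (Fin (q+1) → S) → S) (hQ : IsPolyDer k S (q+1) Q)
    -- DP = Δ(P)
    (DP : (Fin p → S) → S)
    (hDP : ∀ (a : Fin p → S) (x : S),
      B (DP a) x = (-1 : ℤ)^p • B (P (Fin.snoc a x)) 1)
    -- D₁ = Δ(P ∧₁ Q)
    (D₁ : (Fin (p+q+1) → S) → S)
    (hD₁ : ∀ (a : Fin (p+q+1) → S) (x : S),
      B (D₁ a) x = (-1 : ℤ)^(p+q+1) •
        B (wedgeFstProd S (p+1) (q+1) (p+q+2) (by omega) (by omega) P Q (Fin.snoc a x)) 1) :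
    ∀ a : Fin (p+q+1) → S,
      circProd S (p+1) (q+1) (p+q+1) (by omega) (by omega) P Q a
        + (-1 : ℤ)^(p*(q+1)) •
            (D₁ a - wedgeProd S p (q+1) (p+q+1) (by omega) DP Q a) = 0 := by
  intro a
  have key : D₁ a - wedgeProd S p (q+1) (p+q+1) (by omega) DP Q a =
      -((-1 : ℤ) ^ p • ∑ σ : Equiv.Perm (Fin (p+q+1)), if IsShuffle p σ then
        (Equiv.Perm.sign σ : ℤ) • P (Fin.snoc (fun i => a (σ ⟨(i : ℕ), by omega⟩))
          (Q (fun j => a (σ ⟨p + (j : ℕ), by omega⟩)))) else 0) := by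
    rw [← sub_eq_zero]
    refine hBnd _ fun x => ?_
    have hpush (y : S) (f : Equiv.Perm (Fin (p+q+1)) → S) :
        B (∑ σ, if IsShuffle p σ then (Equiv.Perm.sign σ : ℤ) • f σ else 0) y =
          ∑ σ, if IsShuffle p σ then (Equiv.Perm.sign σ : ℤ) • B (f σ) y else 0 := by
      simp only [map_sum, LinearMap.sum_apply]
      refine Finset.sum_congr rfl fun σ _ => ?_
      split_ifs
      · rw [map_zsmul, LinearMap.smul_apply]
      · simp
    have hsq : (-1 : ℤ) ^ (p + q + 1) * (-1) ^ (q + 1) = (-1) ^ p := by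
      rw [add_assoc, pow_add, mul_assoc, ← mul_pow]
      simp
    have hterm (b : Fin p → S) (y : S) : B (DP b * y) x =
        (-1 : ℤ) ^ p • B (P (Fin.snoc b x) * y) 1 + (-1 : ℤ) ^ p • B (P (Fin.snoc b y)) x := by
      rw [hBassoc, hDP, hP.2.2.snoc_mul, map_add, LinearMap.add_apply, smul_add, mul_comm y,
        mul_comm x, hBassoc _ x, mul_one]
    rw [map_sub, LinearMap.sub_apply, map_sub, LinearMap.sub_apply, hD₁,
      wedgeFstProd_snoc p (q + 1) (p + q + 1) (by omega), map_zsmul, LinearMap.smul_apply,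
      smul_smul, hsq, map_neg, LinearMap.neg_apply, map_zsmul, LinearMap.smul_apply, wedgeProd,
      wedgeProd, hpush, hpush, hpush, Finset.smul_sum, Finset.smul_sum, sub_neg_eq_add,
      ← Finset.sum_sub_distrib, ← Finset.sum_add_distrib]
    refine Finset.sum_eq_zero fun σ _ => ?_
    split_ifs
    · rw [hterm]
      simp only [zsmul_eq_mul]
      ring
    · simp
  rw [key, circProd_eq_sum_snoc p (q + 1) (p + q + 1) (by omega) (by omega) P hP.2.1, smul_neg,
    smul_smul, add_neg_cancel]
end

section
/- Let k be a field and define the bracket on k[x, y, z] by {a, b} := xy(∂_x a ∂_y b − ∂_y a ∂_x b) + yz(∂_y a ∂_z b − ∂_z a ∂_y b) − xz(∂_x a ∂_z b − ∂_z a ∂_x b). Then for all a, b ∈ k[x, y, z], the coefficient of the monomial xyz in {a, b} is 0. (Since no element of the ideal (x², y², z²) contains the monomial xyz, this says precisely that the induced Frobenius Poisson algebra S = k[x,y,z]/(x², y², z²), with Frobenius form ⟨u, v⟩ := coefficient of xyz in uv, satisfies ⟨{u, v}, 1⟩ = 0 for all u, v ∈ S, i.e. S is a unimodular Poisson algebra.)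 -/
open MvPolynomial

/-- The bracket `{a, b} = xy(∂ₓa ∂ᵧb − ∂ᵧa ∂ₓb) + yz(∂ᵧa ∂_z b − ∂_z a ∂ᵧb)
− xz(∂ₓa ∂_z b − ∂_z a ∂ₓb)` on `k[x, y, z]`, where `x = X 0`, `y = X 1`,
`z = X 2`. -/
noncomputable def pbr {k : Type*} [CommRing k]
    (a b : MvPolynomial (Fin 3) k) : MvPolynomial (Fin 3) k :=
  X 0 * X 1 * (pderiv 0 a * pderiv 1 b - pderiv 1 a * pderiv 0 b)
  + X 1 * X 2 * (pderiv 1 a * pderiv 2 b - pderiv 2 a * pderiv 1 b)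
  - X 0 * X 2 * (pderiv 0 a * pderiv 2 b - pderiv 2 a * pderiv 0 b)

/-- The bracket is log-canonical: on monomials it multiplies the product by a skew form in the
exponents. -/
theorem pbr_monomial {k : Type*} [CommRing k] (s t : Fin 3 →₀ ℕ) (c d : k) :
    pbr (monomial s c) (monomial t d) = monomial (s + t) (c * d *
      (((s 0 : k) * t 1 - s 1 * t 0) + (s 1 * t 2 - s 2 * t 1) - (s 0 * t 2 - s 2 * t 0))) := by
  have hX (u : Fin 3 →₀ ℕ) (e : k) (i : Fin 3) :
      X i * pderiv i (monomial u e) = monomial u e * C (u i : k) := by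
    rw [X_mul_pderiv_monomial, nsmul_eq_mul, map_natCast, mul_comm]
  have hM : (monomial (s + t) (c * d *
      (((s 0 : k) * t 1 - s 1 * t 0) + (s 1 * t 2 - s 2 * t 1) - (s 0 * t 2 - s 2 * t 0))) :
      MvPolynomial (Fin 3) k) = monomial s c * monomial t d *
      C (((s 0 : k) * t 1 - s 1 * t 0) + (s 1 * t 2 - s 2 * t 1) -
        (s 0 * t 2 - s 2 * t 0)) := by
    rw [monomial_mul, mul_comm _ (C _), C_mul_monomial, mul_comm (c * d)]
  rw [hM]
  simp only [pbr, map_add, map_sub, map_mul]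
  calc
    _ = (X 0 * pderiv 0 (monomial s c)) * (X 1 * pderiv 1 (monomial t d))
        - (X 1 * pderiv 1 (monomial s c)) * (X 0 * pderiv 0 (monomial t d))
        + ((X 1 * pderiv 1 (monomial s c)) * (X 2 * pderiv 2 (monomial t d))
        - (X 2 * pderiv 2 (monomial s c)) * (X 1 * pderiv 1 (monomial t d)))
        - ((X 0 * pderiv 0 (monomial s c)) * (X 2 * pderiv 2 (monomial t d))
        - (X 2 * pderiv 2 (monomial s c)) * (X 0 * pderiv 0 (monomial t d))) := by ring
    _ = _ := by
      simp only [hX]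
      ring

theorem pbr_add_left {k : Type*} [CommRing k] (a a' b : MvPolynomial (Fin 3) k) :
    pbr (a + a') b = pbr a b + pbr a' b := by
  simp only [pbr, map_add]
  ring

theorem pbr_add_right {k : Type*} [CommRing k] (a b b' : MvPolynomial (Fin 3) k) :
    pbr a (b + b') = pbr a b + pbr a b' := by
  simp only [pbr, map_add]
  ring

/-- for all `a, b ∈ k[x,y,z]`, the coefficient of the monomial
`xyz` in `{a, b}` vanishes.  (Since no element of `(x², y², z²)` involves the
monomial `xyz`, this says exactly that the induced Frobenius Poisson algebra
`S = k[x,y,z]/(x², y², z²)`, with Frobenius form `⟨u, v⟩ = (coefficient of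
`xyz` in `uv`)`, satisfies `⟨{u,v}, 1⟩ = 0`, i.e. `S` is unimodular.) -/
theorem bracket_xyz_coeff_zero (k : Type*) [Field k]
    (a b : MvPolynomial (Fin 3) k) :
    MvPolynomial.coeff
      (Finsupp.single (0 : Fin 3) 1 + Finsupp.single 1 1 + Finsupp.single 2 1)
      (pbr a b) = 0 := by
  rw [← a.support_sum_monomial_coeff]
  induction a.support using Finset.induction_on with
  | empty => simp [pbr]
  | insert s S hs ihS =>
    rw [Finset.sum_insert hs, pbr_add_left, coeff_add, ihS, add_zero]
    rw [← b.support_sum_monomial_coeff]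
    induction b.support using Finset.induction_on with
    | empty => simp [pbr]
    | insert t T ht ihT =>
      rw [Finset.sum_insert ht, pbr_add_right, coeff_add, ihT, add_zero, pbr_monomial,
        coeff_monomial]
      split_ifs with h
      · have hsum (i : Fin 3) : (s i : k) + t i = 1 := by
          have hi : s i + t i = 1 := by
            rw [← Finsupp.add_apply, h]
            fin_cases i <;> simp
          exact_mod_cast congrArg (Nat.cast : ℕ → k) hi
        have ht (i : Fin 3) : (t i : k) = 1 - s i := eq_sub_of_add_eq' (hsum i)
        rw [ht 0, ht 1, ht 2]
        ring
      · rfl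
end
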